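/- arXiv:2307.07004 — 2 statements merged into one kernel-verified Lean document; each statement's English description precedes it below -/
import Mathlib

section
/- Let k be an even nonnegative integer and let s be a complex number with Re(s) > -k/2. Define the Schwartz function Φ_∞^{(k)}(x,y) := 2^{1-k} (x+iy)^k e^{-π(x²+y²)} on ℝ². Then ∫_{ℝ∖{0}} Φ_∞^{(k)}(0,a) · |a|^{2s} · (da/|a|) = i^k · 2^{s - k/2} · Γ_ℂ(s + k/2), where the integral is with respect to Lebesgue measure on ℝ∖{0} weighted by 1/|a|, and |a|^{2s} denotes the principal complex power of the positive real |a|. -/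
open MeasureTheory Complex

/-- The completed complex Gamma factor `Γ_ℂ(z) = 2 (2π)^{-z} Γ(z)`. -/
noncomputable def GammaC (z : ℂ) : ℂ := 2 * (2 * Real.pi : ℂ) ^ (-z) * Complex.Gamma z

/-- The archimedean Schwartz function `Φ_∞^{(k)}(x,y) = 2^{1-k} (x+iy)^k e^{-π(x²+y²)}`. -/
noncomputable def PhiInf (k : ℕ) (x y : ℝ) : ℂ :=
  (2 : ℂ) ^ ((1 : ℤ) - (k : ℤ)) * ((x : ℂ) + Complex.I * (y : ℂ)) ^ k
    * Complex.exp ((-(Real.pi * (x ^ 2 + y ^ 2)) : ℝ) : ℂ)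

/-- The Mellin transform of a Gaussian: `∫₀^∞ 2 x^{2w-1} e^{-πx²} dx = π^{-w} Γ(w)`. -/
theorem integral_Ioi_cpow_mul_exp_neg_pi_sq {w : ℂ} (hw : 0 < w.re) :
    ∫ x in Set.Ioi (0 : ℝ), 2 * (x : ℂ) ^ (2 * w - 1) * Complex.exp (-(Real.pi * x ^ 2))
      = (Real.pi : ℂ) ^ (-w) * Complex.Gamma w := by
  have hpi : (Real.pi : ℂ).arg ≠ Real.pi := by
    rw [Complex.arg_ofReal_of_nonneg Real.pi_pos.le]
    exact Real.pi_pos.ne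
  have hG := Complex.integral_cpow_mul_exp_neg_mul_Ioi hw Real.pi_pos
  rw [one_div, Complex.inv_cpow _ _ hpi, ← Complex.cpow_neg,
    ← integral_comp_rpow_Ioi_of_pos (p := 2) two_pos] at hG
  rw [← hG]
  refine setIntegral_congr_fun measurableSet_Ioi fun x hx => ?_
  have hx0 : (x : ℂ) ≠ 0 := Complex.ofReal_ne_zero.mpr (ne_of_gt hx)
  have hsq : ((x ^ 2 : ℝ) : ℂ) ^ (w - 1) = (x : ℂ) ^ (2 * w - 2) := by
    rw [sq, Complex.ofReal_mul, Complex.mul_cpow_ofReal_nonneg (le_of_lt hx) (le_of_lt hx),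
      ← Complex.cpow_add _ _ hx0]
    ring_nf
  have hpow : (x : ℂ) ^ (2 * w - 1) = x * (x : ℂ) ^ (2 * w - 2) := by
    rw [show 2 * w - 1 = 1 + (2 * w - 2) by ring, Complex.cpow_add _ _ hx0, Complex.cpow_one]
  simp only [Real.rpow_two, hsq, hpow, Complex.real_smul]
  norm_num
  ring

/-- An even function on the punctured line integrates to twice its integral over `(0, ∞)`. -/
theorem integral_compl_singleton_zero_of_even {f : ℝ → ℂ} (heven : ∀ x, f (-x) = f x)
    (hf : IntegrableOn f (Set.Ioi 0)) :
    ∫ x in ({0}ᶜ : Set ℝ), f x = 2 * ∫ x in Set.Ioi (0 : ℝ), f x := by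
  have hI : IntegrableOn f (Set.Iio 0) := by
    simpa [heven] using IntegrableOn.comp_neg_Iio (f := f) (c := 0) (by simpa using hf)
  have hneg : ∫ x in Set.Iio (0 : ℝ), f x = ∫ x in Set.Ioi (0 : ℝ), f x := by
    rw [← integral_Iic_eq_integral_Iio]
    simpa [heven] using (integral_comp_neg_Ioi (0 : ℝ) f).symm
  rw [← Set.Iio_union_Ioi, setIntegral_union Set.Iio_disjoint_Ioi_same measurableSet_Ioi hI hf,
    hneg, two_mul]

/-- The value of the archimedean Godement–Siegel section at the identity:
`∫_{ℝ∖{0}} Φ_∞^{(k)}(0,a) |a|^{2s} da/|a| = i^k 2^{s-k/2} Γ_ℂ(s+k/2)`. -/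
theorem arch_siegel_section (k : ℕ) (hk : Even k) (s : ℂ) (hs : -((k : ℝ) / 2) < s.re) :
    ∫ a in ({0}ᶜ : Set ℝ),
        PhiInf k 0 a * ((|a| : ℝ) : ℂ) ^ (2 * s) * ((|a| : ℝ) : ℂ)⁻¹
      = Complex.I ^ k * (2 : ℂ) ^ (s - (k : ℂ) / 2) * GammaC (s + (k : ℂ) / 2) := by
  set w : ℂ := s + (k : ℂ) / 2 with hwdef
  have hw : 0 < w.re := by
    have : w.re = s.re + (k : ℝ) / 2 := by simp [hwdef]
    linarith
  have hpi : (Real.pi : ℂ) ≠ 0 := Complex.ofReal_ne_zero.mpr Real.pi_ne_zero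
  have hIoi : ∫ a in Set.Ioi (0 : ℝ),
      PhiInf k 0 a * ((|a| : ℝ) : ℂ) ^ (2 * s) * ((|a| : ℝ) : ℂ)⁻¹
      = Complex.I ^ k * (2 : ℂ) ^ (-(k : ℤ)) * ((Real.pi : ℂ) ^ (-w) * Complex.Gamma w) := by
    rw [← integral_Ioi_cpow_mul_exp_neg_pi_sq hw, ← integral_const_mul]
    refine setIntegral_congr_fun measurableSet_Ioi fun a ha => ?_
    have ha0 : (a : ℂ) ≠ 0 := Complex.ofReal_ne_zero.mpr (ne_of_gt ha)
    have hpow : (a : ℂ) ^ (2 * w - 1) = (a : ℂ) ^ k * (a : ℂ) ^ (2 * s) * (a : ℂ)⁻¹ := by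
      rw [show 2 * w - 1 = (k : ℂ) + 2 * s + -1 by rw [hwdef]; ring, Complex.cpow_add _ _ ha0,
        Complex.cpow_add _ _ ha0, Complex.cpow_natCast, Complex.cpow_neg_one]
    simp only [PhiInf, abs_of_pos (Set.mem_Ioi.mp ha), hpow,
      sub_eq_add_neg (1 : ℤ), zpow_add₀ (two_ne_zero' ℂ), zpow_one]
    push_cast
    simp only [zero_add, mul_pow, ne_eq, OfNat.ofNat_ne_zero, not_false_eq_true, zero_pow]
    ring
  have hne : Complex.I ^ k * (2 : ℂ) ^ (-(k : ℤ)) *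
      ((Real.pi : ℂ) ^ (-w) * Complex.Gamma w) ≠ 0 :=
    mul_ne_zero (mul_ne_zero (pow_ne_zero _ Complex.I_ne_zero) (zpow_ne_zero _ two_ne_zero))
      (mul_ne_zero (by simp [Complex.cpow_eq_zero_iff, hpi]) (Complex.Gamma_ne_zero_of_re_pos hw))
  rw [integral_compl_singleton_zero_of_even (fun a => by simp [PhiInf, hk.neg_pow])
    (Integrable.of_integral_ne_zero (hIoi ▸ hne)), hIoi, GammaC]
  have htwo : (2 : ℂ) ^ (s - (k : ℂ) / 2) * (2 * Real.pi : ℂ) ^ (-w)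
      = (2 : ℂ) ^ (-(k : ℤ)) * (Real.pi : ℂ) ^ (-w) := by
    have h := Complex.mul_cpow_ofReal_nonneg zero_le_two Real.pi_pos.le (-w)
    rw [Complex.ofReal_ofNat] at h
    rw [h, ← mul_assoc, ← Complex.cpow_add _ _ two_ne_zero, ← Complex.cpow_intCast]
    congr 2
    rw [hwdef]
    push_cast
    ring
  linear_combination (-2 * Complex.I ^ k * Complex.Gamma w) * htwo
end

section
/- Let k1 > k2 ≥ 1 be integers of the same parity, let D > 0 be a real number, and let s be a complex number with Re(s) > -(k1-k2)/2. Then the product (∫_{0}^{∞} y^{(k1+k2)/2 + s - 1} e^{-4πy/√D} (dy/y)) · (∫_{ℝ∖{0}} 2^{1-(k1-k2)} (ia)^{k1-k2} e^{-πa²} |a|^{2s} (da/|a|)) equals i^{k1-k2} · 2^{-k1} · (√D)^{s - 1 + (k1+k2)/2} · Γ_ℂ(s - 1 + (k1+k2)/2) · Γ_ℂ(s + (k1-k2)/2). -/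
open MeasureTheory Complex

/-- The Mellin transform of `y ↦ e^{-ry}` with respect to the multiplicative measure `dy / y`. -/
lemma integral_cpow_mul_exp_neg_mul_inv {w : ℂ} {r : ℝ} (hw : 0 < w.re) (hr : 0 < r) :
    ∫ y in Set.Ioi (0 : ℝ), (y : ℂ) ^ w * Complex.exp ((-(r * y) : ℝ) : ℂ) * (y : ℂ)⁻¹
      = (r : ℂ) ^ (-w) * Complex.Gamma w := by
  have h := Complex.integral_cpow_mul_exp_neg_mul_Ioi hw hr
  rw [one_div, Complex.inv_cpow_ofReal_nonneg hr.le, ← Complex.cpow_neg] at h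
  rw [← h]
  refine setIntegral_congr_fun measurableSet_Ioi fun y hy => ?_
  have hy0 : (y : ℂ) ≠ 0 := Complex.ofReal_ne_zero.mpr (ne_of_gt hy)
  rw [Complex.cpow_sub _ _ hy0, Complex.cpow_one]
  push_cast
  ring

/-- The Mellin transform of the Gaussian `a ↦ e^{-πa²}` over `a > 0`, evaluated at `2z`. -/
lemma integral_cpow_mul_exp_neg_pi_mul_sq {z : ℂ} (hz : 0 < z.re) :
    ∫ a in Set.Ioi (0 : ℝ),
        (a : ℂ) ^ (2 * z) * Complex.exp ((-(Real.pi * a ^ 2) : ℝ) : ℂ) * (a : ℂ)⁻¹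
      = 2⁻¹ * ((Real.pi : ℂ) ^ (-z) * Complex.Gamma z) := by
  rw [← integral_cpow_mul_exp_neg_mul_inv hz Real.pi_pos,
    ← integral_comp_rpow_Ioi_of_pos (two_pos (α := ℝ))
      (g := fun y : ℝ => (y : ℂ) ^ z * Complex.exp ((-(Real.pi * y) : ℝ) : ℂ) * (y : ℂ)⁻¹), ← integral_const_mul]
  refine setIntegral_congr_fun measurableSet_Ioi fun a ha => ?_
  have ha' : (0 : ℝ) < a := ha
  have ha0 : (a : ℂ) ≠ 0 := Complex.ofReal_ne_zero.mpr ha'.ne'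
  have hsq : a ^ (2 : ℝ) = a ^ 2 := Real.rpow_two a
  have hpow : ((a ^ 2 : ℝ) : ℂ) ^ z = (a : ℂ) ^ (2 * z) := by
    rw [two_mul, Complex.cpow_add _ _ ha0, pow_two, Complex.ofReal_mul,
      Complex.mul_cpow_ofReal_nonneg ha'.le ha'.le]
  have hone : a ^ ((2 : ℝ) - 1) = a := by norm_num
  simp only [hsq, hone, hpow, Complex.real_smul]
  push_cast
  field_simp

/-- The integral over `ℝ` of a vector-valued function of `|x|` is twice its integral over `x > 0`. -/
lemma integral_comp_abs_eq_two_smul {E : Type*} [NormedAddCommGroup E] [NormedSpace ℝ E] (f : ℝ → E) :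
    ∫ x : ℝ, f |x| = (2 : ℝ) • ∫ x in Set.Ioi (0 : ℝ), f x := by
  simpa [Measure.real] using integral_fun_norm_addHaar (volume : Measure ℝ) f

/-- The Siegel-section integral over `ℝ ∖ {0}` for an even weight `n`. -/
lemma integral_gaussian_weight_even {n : ℤ} (hn : Even n) {s : ℂ}
    (hs : 0 < (s + (n : ℂ) / 2).re) (c : ℂ) :
    ∫ a in ({0}ᶜ : Set ℝ),
        c * (Complex.I * (a : ℂ)) ^ n * Complex.exp ((-(Real.pi * a ^ 2) : ℝ) : ℂ)
          * ((|a| : ℝ) : ℂ) ^ (2 * s) * ((|a| : ℝ) : ℂ)⁻¹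
      = c * Complex.I ^ n
          * ((Real.pi : ℂ) ^ (-(s + (n : ℂ) / 2)) * Complex.Gamma (s + (n : ℂ) / 2)) := by
  have hcongr : ∀ a ∈ ({0}ᶜ : Set ℝ),
      c * (Complex.I * (a : ℂ)) ^ n * Complex.exp ((-(Real.pi * a ^ 2) : ℝ) : ℂ)
          * ((|a| : ℝ) : ℂ) ^ (2 * s) * ((|a| : ℝ) : ℂ)⁻¹
        = c * Complex.I ^ n * (((|a| : ℝ) : ℂ) ^ (2 * (s + (n : ℂ) / 2))
          * Complex.exp ((-(Real.pi * |a| ^ 2) : ℝ) : ℂ) * ((|a| : ℝ) : ℂ)⁻¹) := by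
    intro a ha
    have ha0 : ((|a| : ℝ) : ℂ) ≠ 0 := Complex.ofReal_ne_zero.mpr (abs_ne_zero.mpr ha)
    have habs : (a : ℂ) ^ n = ((|a| : ℝ) : ℂ) ^ n := by
      rw [← Complex.ofReal_zpow, ← Complex.ofReal_zpow, hn.zpow_abs]
    have hexp : 2 * (s + (n : ℂ) / 2) = 2 * s + n := by ring
    rw [mul_zpow, habs, sq_abs, hexp, Complex.cpow_add _ _ ha0, Complex.cpow_intCast]
    ring
  rw [setIntegral_congr_fun (measurableSet_singleton _).compl hcongr, restrict_compl_singleton,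
    integral_const_mul,
    integral_comp_abs_eq_two_smul (f := fun a : ℝ => (a : ℂ) ^ (2 * (s + (n : ℂ) / 2))
      * Complex.exp ((-(Real.pi * a ^ 2) : ℝ) : ℂ) * (a : ℂ)⁻¹),
    integral_cpow_mul_exp_neg_pi_mul_sq hs]
  simp

/-- The archimedean Asai zeta integral: the product of the torus integral and the
Siegel-section integral equals
`i^{k1-k2} 2^{-k1} (√D)^{s-1+(k1+k2)/2} Γ_ℂ(s-1+(k1+k2)/2) Γ_ℂ(s+(k1-k2)/2)`. -/
theorem arch_asai_zeta_integral (k1 k2 : ℤ) (hk : k2 < k1) (hk2 : 1 ≤ k2)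
    (hpar : k1 % 2 = k2 % 2) (D : ℝ) (hD : 0 < D) (s : ℂ)
    (hs : -(((k1 : ℝ) - (k2 : ℝ)) / 2) < s.re) :
    (∫ y in Set.Ioi (0 : ℝ),
        (y : ℂ) ^ (((k1 : ℂ) + (k2 : ℂ)) / 2 + s - 1)
          * Complex.exp ((-(4 * Real.pi * y / Real.sqrt D) : ℝ) : ℂ) * (y : ℂ)⁻¹)
      * (∫ a in ({0}ᶜ : Set ℝ),
          (2 : ℂ) ^ (1 - (k1 - k2)) * (Complex.I * (a : ℂ)) ^ (k1 - k2)
            * Complex.exp ((-(Real.pi * a ^ 2) : ℝ) : ℂ)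
            * ((|a| : ℝ) : ℂ) ^ (2 * s) * ((|a| : ℝ) : ℂ)⁻¹)
      = Complex.I ^ (k1 - k2) * (2 : ℂ) ^ (-k1)
          * (Real.sqrt D : ℂ) ^ (s - 1 + ((k1 : ℂ) + (k2 : ℂ)) / 2)
          * GammaC (s - 1 + ((k1 : ℂ) + (k2 : ℂ)) / 2)
          * GammaC (s + ((k1 : ℂ) - (k2 : ℂ)) / 2) := by
  have hk2' : (1 : ℝ) ≤ k2 := by exact_mod_cast hk2
  have heven : Even (k1 - k2) := by rw [Int.even_iff]; omega
  have hz : 0 < (s + ((k1 - k2 : ℤ) : ℂ) / 2).re := by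
    have : (s + ((k1 - k2 : ℤ) : ℂ) / 2) = s + ((((k1 : ℝ) - k2) / 2 : ℝ) : ℂ) := by
      push_cast; ring
    rw [this, Complex.add_re, Complex.ofReal_re]
    linarith
  have hw : 0 < (s - 1 + ((k1 : ℂ) + (k2 : ℂ)) / 2).re := by
    have : s - 1 + ((k1 : ℂ) + (k2 : ℂ)) / 2 = s + ((((k1 : ℝ) + k2) / 2 - 1 : ℝ) : ℂ) := by
      push_cast; ring
    rw [this, Complex.add_re, Complex.ofReal_re]
    linarith
  have hsqrt : 0 < Real.sqrt D := Real.sqrt_pos.mpr hD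
  have hr : 0 < 2 * (2 * Real.pi) * (Real.sqrt D)⁻¹ := by positivity
  have htorus := integral_cpow_mul_exp_neg_mul_inv hw hr
  rw [show ((k1 : ℂ) + (k2 : ℂ)) / 2 + s - 1 = s - 1 + ((k1 : ℂ) + (k2 : ℂ)) / 2 by ring]
  simp_rw [show ∀ y : ℝ, 4 * Real.pi * y / Real.sqrt D
    = 2 * (2 * Real.pi) * (Real.sqrt D)⁻¹ * y from fun y => by ring]
  rw [htorus, integral_gaussian_weight_even heven hz, Int.cast_sub, GammaC, GammaC]
  have hwz : s + ((k1 : ℂ) - (k2 : ℂ)) / 2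
      = s - 1 + ((k1 : ℂ) + (k2 : ℂ)) / 2 + ((1 - k2 : ℤ) : ℂ) := by push_cast; ring
  generalize hwdef : s - 1 + ((k1 : ℂ) + (k2 : ℂ)) / 2 = w at *
  generalize hzdef : s + ((k1 : ℂ) - (k2 : ℂ)) / 2 = z at *
  have hsplit : ((2 * (2 * Real.pi) * (Real.sqrt D)⁻¹ : ℝ) : ℂ) ^ (-w)
      = (2 : ℂ) ^ (-w) * (2 * Real.pi : ℂ) ^ (-w) * (Real.sqrt D : ℂ) ^ w := by
    rw [Complex.ofReal_mul, Complex.mul_cpow_ofReal_nonneg (by positivity) (by positivity),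
      Complex.ofReal_mul, Complex.mul_cpow_ofReal_nonneg (by positivity) (by positivity),
      Complex.ofReal_inv, Complex.inv_cpow_ofReal_nonneg hsqrt.le,
      Complex.cpow_neg (Real.sqrt D : ℂ), inv_inv]
    push_cast
    rfl
  have hpi : (2 * Real.pi : ℂ) ^ (-z) = (2 : ℂ) ^ (-z) * (Real.pi : ℂ) ^ (-z) := by
    exact_mod_cast Complex.mul_cpow_ofReal_nonneg zero_le_two Real.pi_pos.le (-z)
  have htwo : (2 : ℂ) ^ (1 - (k1 - k2)) * (2 : ℂ) ^ (-w)
      = 4 * (2 : ℂ) ^ (-k1) * (2 : ℂ) ^ (-z) := by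
    have h2 : (2 : ℂ) ≠ 0 := two_ne_zero
    rw [hwz, show -(w + ((1 - k2 : ℤ) : ℂ)) = -w + ((k2 - 1 : ℤ) : ℂ) by push_cast; ring,
      Complex.cpow_add _ _ h2, Complex.cpow_intCast,
      show 1 - (k1 - k2) = 2 + -k1 + (k2 - 1) by ring, zpow_add₀ h2, zpow_add₀ h2]
    norm_num
    ring
  rw [hsplit, hpi]
  linear_combination (Complex.I ^ (k1 - k2) * (2 * Real.pi : ℂ) ^ (-w) * (Real.sqrt D : ℂ) ^ w
    * Complex.Gamma w * (Real.pi : ℂ) ^ (-z) * Complex.Gamma z) * htwo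
end
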